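/- Let q be a prime with q ≡ 1 (mod 6) or q = 3, and let s be an integer with q ∣ Φ₆(s), where Φ₆(x) = x² − x + 1. Then for every integer x, Φ₆(Φ₄(q·x + s)) = q · f₃(x) · f₄(x), where f₃(x) = q²·x² + (2s + 1)·q·x + Φ₃(s) and f₄(x) = q·x² + (2s − 1)·x + Φ₆(s)/q, with Φ₃(x) = x² + x + 1 and Φ₄(x) = x² + 1. Moreover f₃ and f₄ are irreducible as polynomials over ℤ. -/

import Mathlib

open Polynomial

/-- The 3rd cyclotomic polynomial, evaluated at an integer. -/
def Phi3 (x : ℤ) : ℤ := x ^ 2 + x + 1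

/-- The 4th cyclotomic polynomial, evaluated at an integer. -/
def Phi4 (x : ℤ) : ℤ := x ^ 2 + 1

/-- The 6th cyclotomic polynomial, evaluated at an integer. -/
def Phi6 (x : ℤ) : ℤ := x ^ 2 - x + 1

theorem coeff_two_quadratic {R : Type*} [Semiring R] (a b c : R) :
    (C a * X ^ 2 + C b * X + C c).coeff 2 = a := by
  simp

theorem coeff_one_quadratic {R : Type*} [Semiring R] (a b c : R) :
    (C a * X ^ 2 + C b * X + C c).coeff 1 = b := by
  simp [coeff_C]

theorem coeff_zero_quadratic {R : Type*} [Semiring R] (a b c : R) :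
    (C a * X ^ 2 + C b * X + C c).coeff 0 = c := by
  simp [coeff_X, coeff_C]

/-- A primitive integer quadratic with negative discriminant is irreducible. -/
theorem irreducible_quadratic_of_discrim_neg {a b c : ℤ} (hdisc : discrim a b c < 0)
    (hprim : ∀ d : ℤ, d ∣ a → d ∣ b → d ∣ c → IsUnit d) :
    Irreducible (C a * X ^ 2 + C b * X + C c) := by
  have ha : a ≠ 0 := by
    rintro rfl
    unfold discrim at hdisc
    nlinarith [sq_nonneg b]
  have hdeg := natDegree_quadratic (b := b) (c := c) ha
  have const_unit (f g : ℤ[X]) (h : C a * X ^ 2 + C b * X + C c = f * g)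
      (hf : f.natDegree = 0) : IsUnit f := by
    obtain ⟨d, rfl⟩ := natDegree_eq_zero.mp hf
    have hd := (C_dvd_iff_dvd_coeff d _).mp (Dvd.intro g h.symm)
    refine isUnit_C.mpr (hprim d ?_ ?_ ?_)
    · simpa only [coeff_two_quadratic] using hd 2
    · simpa only [coeff_one_quadratic] using hd 1
    · simpa only [coeff_zero_quadratic] using hd 0
  refine ⟨fun hu => ?_, fun f g h => ?_⟩
  · rw [natDegree_eq_zero_of_isUnit hu] at hdeg
    omega
  · by_cases hf : f.natDegree = 0
    · exact Or.inl (const_unit f g h hf)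
    by_cases hg : g.natDegree = 0
    · exact Or.inr (const_unit g f (h.trans (mul_comm f g)) hg)
    exfalso
    have hf0 : f ≠ 0 := by rintro rfl; simp at hf
    have hg0 : g ≠ 0 := by rintro rfl; simp at hg
    rw [h, natDegree_mul hf0 hg0] at hdeg
    obtain ⟨m, n, rfl⟩ := exists_eq_X_add_C_of_natDegree_le_one (p := f) (by omega)
    obtain ⟨k, l, rfl⟩ := exists_eq_X_add_C_of_natDegree_le_one (p := g) (by omega)
    have hprod : (C m * X + C n) * (C k * X + C l) =
        C (m * k) * X ^ 2 + C (m * l + n * k) * X + C (n * l) := by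
      simp only [C_mul, C_add]
      ring
    rw [hprod] at h
    have h2 : a = m * k := by
      simpa only [coeff_two_quadratic] using congrArg (coeff · 2) h
    have h1 : b = m * l + n * k := by
      simpa only [coeff_one_quadratic] using congrArg (coeff · 1) h
    have h0 : c = n * l := by
      simpa only [coeff_zero_quadratic] using congrArg (coeff · 0) h
    rw [h2, h1, h0, discrim] at hdisc
    nlinarith [sq_nonneg (m * l - n * k)]

theorem mnt_k6_case_phi6 (q : ℤ) (hq : Prime q) (hmod : q % 6 = 1 ∨ q = 3)
    (s : ℤ) (hdvd : q ∣ Phi6 s) :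
    (∀ x : ℤ, Phi6 (Phi4 (q * x + s)) =
      q * (q ^ 2 * x ^ 2 + (2 * s + 1) * q * x + Phi3 s) *
        (q * x ^ 2 + (2 * s - 1) * x + Phi6 s / q)) ∧
    Irreducible (C (q ^ 2) * X ^ 2 + C ((2 * s + 1) * q) * X + C (Phi3 s)) ∧
    Irreducible (C q * X ^ 2 + C (2 * s - 1) * X + C (Phi6 s / q)) := by
  obtain ⟨t, ht⟩ := hdvd
  have hquot : Phi6 s / q = t := by rw [ht, Int.mul_ediv_cancel_left _ hq.ne_zero]
  rw [hquot]
  unfold Phi6 at ht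
  refine ⟨fun x => ?_, ?_, ?_⟩
  · unfold Phi6 Phi4 Phi3
    linear_combination (q ^ 2 * x ^ 2 + (2 * s + 1) * q * x + (s ^ 2 + s + 1)) * ht
  · apply irreducible_quadratic_of_discrim_neg
    · have : 0 < q ^ 2 := by have := hq.ne_zero; positivity
      unfold discrim Phi3
      nlinarith
    · intro d hd _ hd'
      have hndvd : ¬ q ∣ Phi3 s := by
        intro h
        have h2s : q ∣ 2 * s := by
          have := h.sub (Dvd.intro t ht.symm)
          rwa [Phi3, show s ^ 2 + s + 1 - (s ^ 2 - s + 1) = 2 * s by ring] at this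
        rcases hq.dvd_or_dvd h2s with h2 | hs
        · obtain ⟨k, hk⟩ := h2
          have hq2 : Odd q := by rw [Int.odd_iff]; omega
          have : IsUnit q := by
            have hcop : IsCoprime q 2 := by
              obtain ⟨r, hr⟩ := hq2
              exact ⟨1, -r, by linarith⟩
            exact hcop.isUnit_of_dvd' dvd_rfl ⟨k, hk⟩
          exact hq.not_isUnit this
        · obtain ⟨k, hk⟩ := hs
          refine hq.not_isUnit (isUnit_of_dvd_one ⟨t - k * (s - 1), ?_⟩)
          linear_combination ht - (s - 1) * hk
      have hcop : IsCoprime (q ^ 2) (Phi3 s) :=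
        ((hq.irreducible.coprime_iff_not_dvd).mpr hndvd).pow_left
      exact hcop.isUnit_of_dvd' hd hd'
  · apply irreducible_quadratic_of_discrim_neg
    · unfold discrim
      linarith
    · rintro d ⟨u, hu⟩ ⟨v, hv⟩ ⟨w, hw⟩
      refine Int.prime_three.squarefree d ⟨4 * u * w - v ^ 2, ?_⟩
      linear_combination 4 * ht + 4 * t * hu + 4 * d * u * hw - (2 * s - 1 + d * v) * hv
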